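/- arXiv:1212.6471 — 4 statements merged into one kernel-verified Lean document; each statement's English description precedes it below -/
import Mathlib

section
/- Weierstrass' continuation lemma: let ρ > 0 and let P be analytic and nonconstant on the disk D(0,ρ) = {u : |u| < ρ}. Suppose there is a nonzero polynomial f ∈ ℂ[X,Y] such that f(P(u/2), P(u)) = 0 for all |u| < ρ. Then for every R > 0 there exist an integer N ≥ 1 and functions p_0, p_1, …, p_N analytic on the disk D(0,R), not all identically zero, such that p_0(u) P(u)^N + p_1(u) P(u)^{N-1} + ⋯ + p_N(u) = 0 for all u with |u| < min(ρ, R). -/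
open Metric

/-- An analytic function on a disk that vanishes on a smaller concentric disk vanishes. -/
lemma AnalyticOnNhd.eq_zero_of_eq_zero_on_ball {ρ r : ℝ} (hρ : 0 < ρ) (hr : 0 < r) {G : ℂ → ℂ}
    (hG : AnalyticOnNhd ℂ G (ball 0 ρ)) (h0 : ∀ u ∈ ball (0 : ℂ) r, G u = 0) :
    ∀ u ∈ ball (0 : ℂ) ρ, G u = 0 := by
  have hU : IsPreconnected (ball (0 : ℂ) ρ) := (convex_ball 0 ρ).isPreconnected
  have hev : G =ᶠ[nhds 0] 0 := by
    filter_upwards [ball_mem_nhds (0 : ℂ) hr] with u hu using h0 u hu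
  exact hG.eqOn_zero_of_preconnected_of_eventuallyEq_zero hU (mem_ball_self hρ) hev

/-- The algebra of functions on a set which are restrictions of functions analytic near it. -/
def analyticRestrictions (U : Set ℂ) : Subalgebra ℂ (U → ℂ) where
  carrier := {g | ∃ G : ℂ → ℂ, AnalyticOnNhd ℂ G U ∧ ∀ z : U, g z = G z}
  mul_mem' := by
    rintro a b ⟨A, hA, ha⟩ ⟨B, hB, hb⟩
    exact ⟨A * B, hA.mul hB, fun z => by simp [ha, hb]⟩
  add_mem' := by
    rintro a b ⟨A, hA, ha⟩ ⟨B, hB, hb⟩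
    exact ⟨A + B, hA.add hB, fun z => by simp [ha, hb]⟩
  algebraMap_mem' c := ⟨fun _ => c, analyticOnNhd_const, fun _ => rfl⟩

lemma analyticRestrictions_noZeroDivisors {U : Set ℂ} (hU : IsPreconnected U) :
    NoZeroDivisors (analyticRestrictions U) where
  eq_zero_or_eq_zero_of_mul_eq_zero := by
    rintro ⟨a, A, hA, ha⟩ ⟨b, B, hB, hb⟩ hab
    have hab' : ∀ z ∈ U, A z * B z = 0 := fun z hz => by
      rw [← ha ⟨z, hz⟩, ← hb ⟨z, hz⟩]
      exact congrFun (congrArg Subtype.val hab) ⟨z, hz⟩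
    refine (hA.eq_zero_or_eq_zero_of_mul_eq_zero hB hab' hU).imp ?_ ?_ <;> intro h <;>
      ext z
    · exact (ha z).trans (h z z.2)
    · exact (hb z).trans (h z z.2)

/-- A nontrivial polynomial relation between `x` and `y`, with `x` transcendental, makes `y`
algebraic over the algebra generated by `x`. -/
lemma isAlgebraic_adjoin_of_aeval_eq_zero {F A : Type*} [Field F] [CommRing A] [Algebra F A]
    {x y : A} (hx : Transcendental F x) {f : MvPolynomial (Fin 2) F} (hf : f ≠ 0)
    (h : MvPolynomial.aeval ![x, y] f = 0) : IsAlgebraic (Algebra.adjoin F {x}) y := by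
  by_contra hy
  have hx' : AlgebraicIndependent F (fun _ : Fin 1 => x) :=
    algebraicIndependent_unique_type_iff.mpr hx
  have hopt := (hx'.option_iff_transcendental y).mpr (by rwa [Set.range_const])
  let e : Fin 2 ≃ Option (Fin 1) := (finSuccEquiv' 1)
  have hcomp : AlgebraicIndependent F ![x, y] := by
    refine (algebraicIndependent_equiv' e ?_).mpr hopt
    ext i
    fin_cases i <;> rfl
  exact hf (hcomp.eq_zero_of_aeval_eq_zero f h)

/-- An element of a domain over an algebraically closed field is a constant or transcendental. -/
lemma transcendental_of_forall_ne_algebraMap {F A : Type*} [Field F] [IsAlgClosed F] [CommRing A]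
    [IsDomain A] [Algebra F A] {x : A} (hx : ∀ c : F, x ≠ algebraMap F A c) :
    Transcendental F x := by
  rintro ⟨q, hq, hqx⟩
  have hs := IsAlgClosed.splits q
  rw [hs.eq_prod_roots] at hqx
  simp only [map_mul, Polynomial.aeval_C, map_multiset_prod, Multiset.map_map, mul_eq_zero,
    Multiset.prod_eq_zero_iff, Multiset.mem_map] at hqx
  rcases hqx with h | ⟨c, -, h⟩
  · exact hq (Polynomial.leadingCoeff_eq_zero.mp
      ((map_eq_zero_iff _ (algebraMap F A).injective).mp h))
  · exact hx c (by simpa [sub_eq_zero] using h)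

/-- An algebraic element over `F[x]` satisfies a polynomial equation with coefficients
polynomial in `x`, the leading one being nonzero. -/
lemma exists_sum_aeval_mul_pow_eq_zero {F A : Type*} [Field F] [CommRing A] [Algebra F A] {x y : A}
    (h : IsAlgebraic (Algebra.adjoin F {x}) y) :
    ∃ (d : ℕ) (c : ℕ → Polynomial F), Polynomial.aeval x (c d) ≠ 0 ∧
      ∑ k ∈ Finset.range (d + 1), Polynomial.aeval x (c k) * y ^ k = 0 := by
  obtain ⟨q, hq, hqy⟩ := h
  have hmem : ∀ k, ∃ c : Polynomial F, Polynomial.aeval x c = (q.coeff k : A) := fun k => by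
    have hk : (q.coeff k : A) ∈ (Polynomial.aeval (R := F) x).range :=
      Algebra.adjoin_singleton_eq_range_aeval F x ▸ (q.coeff k).2
    exact hk
  choose c hc using hmem
  refine ⟨q.natDegree, c, ?_, ?_⟩
  · rw [hc]
    simpa using hq
  · simp_rw [hc]
    rw [Polynomial.aeval_eq_sum_range] at hqy
    simpa [Algebra.smul_def] using hqy

/-- If consecutive terms of a sequence of transcendental elements satisfy a fixed nontrivial
polynomial relation, then the first term is algebraic over the algebra generated by any term. -/
lemma isAlgebraic_adjoin_of_forall_aeval_eq_zero {F A : Type*} [Field F] [CommRing A] [IsDomain A]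
    [Algebra F A] {x : ℕ → A} (hx : ∀ n, Transcendental F (x n)) {f : MvPolynomial (Fin 2) F}
    (hf : f ≠ 0) (h : ∀ n, MvPolynomial.aeval ![x (n + 1), x n] f = 0) (n : ℕ) :
    IsAlgebraic (Algebra.adjoin F {x n}) (x 0) := by
  induction n with
  | zero =>
    exact isAlgebraic_algebraMap (⟨x 0, Algebra.subset_adjoin rfl⟩ : Algebra.adjoin F {x 0})
  | succ n ih =>
    refine ih.adjoin_of_forall_isAlgebraic ?_
    rintro _ ⟨rfl, -⟩
    exact isAlgebraic_adjoin_of_aeval_eq_zero (hx (n + 1)) hf (h n)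

/-- **Weierstrass' continuation lemma.**
Let `P` be analytic and nonconstant on the disk `|u| < ρ`, and suppose a nonzero
two-variable polynomial relation `f (P (u/2), P u) = 0` holds on that disk.  Then for
every `R > 0` the function `P` satisfies, on `|u| < min ρ R`, a polynomial equation
`p 0 u * P u ^ N + p 1 u * P u ^ (N-1) + ⋯ + p N u = 0` whose coefficients `p i` are
analytic on the disk `|u| < R` and not all identically zero: `P` is algebroid in every
bounded domain. -/
theorem weierstrass_continuation_lemma (ρ : ℝ) (hρ : 0 < ρ) (P : ℂ → ℂ)
    (hP : AnalyticOnNhd ℂ P (ball (0 : ℂ) ρ))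
    (hPnc : ¬ ∃ c : ℂ, ∀ u ∈ ball (0 : ℂ) ρ, P u = c)
    (f : MvPolynomial (Fin 2) ℂ) (hf : f ≠ 0)
    (hfeq : ∀ u ∈ ball (0 : ℂ) ρ, MvPolynomial.eval ![P (u / 2), P u] f = 0) :
    ∀ R : ℝ, 0 < R → ∃ N : ℕ, 1 ≤ N ∧ ∃ p : Fin (N + 1) → ℂ → ℂ,
      (∀ i, AnalyticOnNhd ℂ (p i) (ball (0 : ℂ) R)) ∧
      (∃ i, ∃ u ∈ ball (0 : ℂ) R, p i u ≠ 0) ∧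
      ∀ u : ℂ, ‖u‖ < min ρ R →
        ∑ i : Fin (N + 1), p i u * P u ^ (N - (i : ℕ)) = 0 := by
  intro R hR
  have hU : IsPreconnected (ball (0 : ℂ) ρ) := (convex_ball 0 ρ).isPreconnected
  let A := analyticRestrictions (ball (0 : ℂ) ρ)
  have : NoZeroDivisors A := analyticRestrictions_noZeroDivisors hU
  have : Nonempty (ball (0 : ℂ) ρ) := ⟨⟨0, mem_ball_self hρ⟩⟩
  have : IsDomain A := NoZeroDivisors.to_isDomain A
  have hscale : ∀ (n : ℕ) (r : ℝ), r ≤ 2 ^ n * ρ → ∀ u ∈ ball (0 : ℂ) r,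
      u / 2 ^ n ∈ ball (0 : ℂ) ρ := fun n r hr u hu => by
    rw [mem_ball_zero_iff] at hu ⊢
    rw [norm_div, norm_pow, Complex.norm_ofNat, div_lt_iff₀' (by positivity)]
    exact hu.trans_le hr
  have hρn : ∀ n : ℕ, ρ ≤ 2 ^ n * ρ := fun n =>
    le_mul_of_one_le_left hρ.le (one_le_pow₀ one_le_two)
  have hana : ∀ (n : ℕ) (r : ℝ), r ≤ 2 ^ n * ρ →
      AnalyticOnNhd ℂ (fun u => P (u / 2 ^ n)) (ball 0 r) := fun n r hr u hu =>
    (hP _ (hscale n r hr u hu)).fun_comp (f := fun u : ℂ => u / 2 ^ n)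
      (analyticAt_id.div_const)
  let x : ℕ → A := fun n => ⟨fun u => P (u / 2 ^ n), _, hana n ρ (hρn n), fun _ => rfl⟩
  have hxapp : ∀ n (u : ball (0 : ℂ) ρ), (x n : ball (0 : ℂ) ρ → ℂ) u = P (u / 2 ^ n) :=
    fun _ _ => rfl
  have htr : ∀ n, Transcendental ℂ (x n) := fun n => by
    refine transcendental_of_forall_ne_algebraMap fun c hc => hPnc ⟨c, fun u hu => ?_⟩
    refine sub_eq_zero.mp (AnalyticOnNhd.eq_zero_of_eq_zero_on_ball (G := fun u => P u - c)
      (r := ρ / 2 ^ n) hρ (by positivity) (hP.sub analyticOnNhd_const) (fun v hv => ?_) u hu)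
    have hv' : v * 2 ^ n ∈ ball (0 : ℂ) ρ := by
      rw [mem_ball_zero_iff] at hv ⊢
      rwa [norm_mul, norm_pow, Complex.norm_ofNat, ← lt_div_iff₀ (by positivity)]
    have h := congrFun (congrArg Subtype.val hc) ⟨v * 2 ^ n, hv'⟩
    rw [hxapp, mul_div_cancel_right₀ v (pow_ne_zero n two_ne_zero)] at h
    exact sub_eq_zero.mpr h
  have heval : ∀ u : ball (0 : ℂ) ρ, ∀ (g : MvPolynomial (Fin 2) ℂ) (a b : A),
      (MvPolynomial.aeval ![a, b] g : A).1 u = MvPolynomial.eval ![a.1 u, b.1 u] g := by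
    intro u g a b
    let φ : A →ₐ[ℂ] ℂ := (Pi.evalAlgHom ℂ (fun _ => ℂ) u).comp A.val
    have hφ : (φ ∘ ![a, b]) = ![a.1 u, b.1 u] := by
      ext i
      fin_cases i <;> rfl
    have h := DFunLike.congr_fun (MvPolynomial.comp_aeval (f := ![a, b]) φ) g
    change φ (MvPolynomial.aeval ![a, b] g) = _
    rw [← hφ, ← MvPolynomial.coe_aeval_eq_eval]
    exact h
  have hrel : ∀ n, MvPolynomial.aeval ![x (n + 1), x n] f = 0 := fun n => by
    ext u
    rw [heval, hxapp, hxapp, pow_succ, ← div_div]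
    exact hfeq _ (hscale n ρ (hρn n) u u.2)
  obtain ⟨n, hn⟩ : ∃ n : ℕ, R ≤ 2 ^ n * ρ := by
    obtain ⟨n, hn⟩ := pow_unbounded_of_one_lt (R / ρ) (one_lt_two (α := ℝ))
    exact ⟨n, ((div_lt_iff₀ hρ).mp hn).le⟩
  obtain ⟨d, c, hcd, hsum⟩ := exists_sum_aeval_mul_pow_eq_zero 
    (isAlgebraic_adjoin_of_forall_aeval_eq_zero htr hf hrel n)
  have haev : ∀ (u : ball (0 : ℂ) ρ) (q : Polynomial ℂ),
      (Polynomial.aeval (x n) q : A).1 u = q.eval (P (u / 2 ^ n)) := by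
    intro u q
    let φ : A →ₐ[ℂ] ℂ := (Pi.evalAlgHom ℂ (fun _ => ℂ) u).comp A.val
    exact (Polynomial.aeval_algHom_apply φ (x n) q).symm
  have hpana : ∀ (r : ℝ), r ≤ 2 ^ n * ρ → ∀ q : Polynomial ℂ,
      AnalyticOnNhd ℂ (fun u => q.eval (P (u / 2 ^ n))) (ball 0 r) := fun r hr q u hu => by
    simpa using (hana n r hr u hu).aeval_polynomial q
  -- Multiplying the equation by `P u` makes its degree positive.
  let c' : ℕ → Polynomial ℂ := fun k => k.casesOn 0 c
  refine ⟨d + 1, Nat.le_add_left 1 d, fun i u => (c' (d + 1 - i)).eval (P (u / 2 ^ n)),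
    fun i => hpana R hn _, ⟨0, ?_⟩, fun u hu => ?_⟩
  · by_contra! h
    refine hcd ?_
    ext u
    rw [haev]
    exact AnalyticOnNhd.eq_zero_of_eq_zero_on_ball hρ hR (hpana ρ (hρn n) (c d)) h u u.2
  · have huρ : u ∈ ball (0 : ℂ) ρ := mem_ball_zero_iff.mpr (hu.trans_le (min_le_left _ _))
    rw [Fin.sum_univ_eq_sum_range
      (fun i => (c' (d + 1 - i)).eval (P (u / 2 ^ n)) * P u ^ (d + 1 - i))]
    refine (Finset.sum_range_reflect
      (fun k => (c' k).eval (P (u / 2 ^ n)) * P u ^ k) (d + 1 + 1)).trans ?_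
    rw [Finset.sum_range_succ']
    let φ : A →ₐ[ℂ] ℂ := (Pi.evalAlgHom ℂ (fun _ => ℂ) ⟨u, huρ⟩).comp A.val
    have h := congrArg φ hsum
    have hφ : ∀ q, φ (Polynomial.aeval (x n) q) = q.eval (P (u / 2 ^ n)) := haev ⟨u, huρ⟩
    have hφ0 : φ (x 0) = P u := (hxapp 0 ⟨u, huρ⟩).trans (by simp)
    simp only [map_sum, map_mul, map_pow, map_zero, hφ, hφ0] at h
    simp only [c', pow_succ, ← mul_assoc, ← Finset.sum_mul, h]
    simp
end

section
/- Let r > 0 and let P₁, P₂, P₃ be analytic and nonconstant on the disk D(0,r) = {x : |x| < r}. Let G ∈ ℂ[X,Y,Z] be an irreducible polynomial with positive degree in each of the three variables, and suppose G(P₁(x), P₂(y), P₃(x+y)) = 0 for all x, y with |x| < r/2 and |y| < r/2. Then there exist a nonzero polynomial Ḡ ∈ ℂ[X,Y,Z] and ρ > 0 such that Ḡ(P₁(x), P₁(y), P₁(x+y)) = 0 for all x, y with |x| < ρ and |y| < ρ. -/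
open Metric

namespace MvPolynomial

variable {σ k : Type*} [DecidableEq σ] [Field k]

/-- A polynomial killed by the substitution `X i ↦ c` is divisible by `X i - c`. -/
theorem X_sub_C_dvd_of_aeval_update_eq_zero (G : MvPolynomial σ k) (i : σ) (c : k)
    (h : aeval (Function.update X i (C c)) G = (0 : MvPolynomial σ k)) :
    X i - C c ∣ G := by
  let I : Ideal (MvPolynomial σ k) := Ideal.span {X i - C c}
  have hcomp : (Ideal.Quotient.mkₐ k I).comp
      (aeval (Function.update (X : σ → MvPolynomial σ k) i (C c))) = Ideal.Quotient.mkₐ k I := by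
    refine algHom_ext fun j ↦ ?_
    rcases eq_or_ne j i with rfl | hj
    · simp only [AlgHom.comp_apply, aeval_X, Function.update_self]
      refine (Ideal.Quotient.eq.2 ?_).symm
      exact Ideal.subset_span rfl
    · simp [Function.update_of_ne hj]
  have hG := DFunLike.congr_fun hcomp G
  rw [AlgHom.comp_apply, h, map_zero] at hG
  exact Ideal.mem_span_singleton.1 (Ideal.Quotient.eq_zero_iff_mem.1 hG.symm)

/-- Specializing one variable of an irreducible polynomial that involves another variable never
gives the zero polynomial. -/
theorem aeval_update_ne_zero_of_irreducible {G : MvPolynomial σ k} (hG : Irreducible G)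
    {i j : σ} (hij : j ≠ i) (hj : 0 < G.degreeOf j) (c : k) :
    aeval (Function.update X i (C c)) G ≠ (0 : MvPolynomial σ k) := by
  intro h
  obtain ⟨u, hu⟩ := X_sub_C_dvd_of_aeval_update_eq_zero G i c h
  rcases hG.isUnit_or_isUnit hu with hX | hX
  · have := hX.map (eval fun _ : σ ↦ c)
    simp at this
  · obtain ⟨a, -, rfl⟩ := isUnit_iff_eq_C_of_isReduced.1 hX
    have h₁ : degreeOf j (X i - C c : MvPolynomial σ k) ≤ 0 :=
      (degreeOf_sub_le j _ _).trans (by simp [degreeOf_X_of_ne hij, degreeOf_C])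
    have h₂ := degreeOf_mul_le j (X i - C c : MvPolynomial σ k) (C a)
    rw [← hu, degreeOf_C] at h₂
    omega

theorem aeval_update_mem_supported (G : MvPolynomial σ k) (i : σ) (c : k) :
    aeval (Function.update (X : σ → MvPolynomial σ k) i (C c)) G ∈ supported k ({i}ᶜ : Set σ) := by
  induction G using MvPolynomial.induction_on with
  | C a => simpa using Subalgebra.algebraMap_mem (supported k ({i}ᶜ : Set σ)) a
  | add p q hp hq => simpa using add_mem hp hq
  | mul_X p j hp =>
    rw [map_mul, aeval_X]
    refine mul_mem hp ?_
    rcases eq_or_ne j i with rfl | hj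
    · simpa using Subalgebra.algebraMap_mem (supported k ({j}ᶜ : Set σ)) c
    · rw [Function.update_of_ne hj]
      exact Algebra.subset_adjoin ⟨j, hj, rfl⟩

end MvPolynomial

section AlgebraicRelations

open AlgebraicIndependent

variable {k A : Type*} [Field k] [CommRing A] [IsDomain A] [Algebra k A]

/-- An irreducible relation between `z j`, `z l` and a constant makes `z j` algebraic over `z l`. -/
theorem mem_matroid_closure_singleton_of_aeval_update {σ : Type*} [DecidableEq σ]
    {G : MvPolynomial σ k} (hG : Irreducible G) {i j l : σ} (hj : j ≠ i)
    (hdeg : 0 < G.degreeOf j) (hijl : ({i}ᶜ : Set σ) = {j, l}) (z : σ → A) (c : k)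
    (hz : MvPolynomial.aeval (Function.update z i (algebraMap k A c)) G = 0)
    (hl : Transcendental k (z l)) :
    z j ∈ (matroid k A).closure {z l} := by
  by_contra hmem
  have hne : z j ≠ z l := fun h ↦
    hmem (h ▸ Matroid.mem_closure_of_mem _ (Set.mem_singleton _) (Set.subset_univ _))
  have hsing : (matroid k A).Indep {z l} := by
    rw [matroid_indep_iff]
    exact (algebraicIndependent_singleton_iff (ι := ({z l} : Set A)) ⟨z l, rfl⟩).2 hl
  have hpair : (matroid k A).Indep {z j, z l} := by
    rw [hsing.insert_indep_iff]
    exact Or.inl ⟨Set.mem_univ _, hmem⟩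
  have hind : AlgebraicIndependent k (z ∘ ((↑) : ({i}ᶜ : Set σ) → σ)) := by
    rw [hijl]
    refine (algebraicIndependent_image (s := {j, l}) (f := z) ?_).2 ?_
    · rw [Set.injOn_pair]
      exact fun h ↦ absurd h hne
    · rw [Set.image_pair]
      exact hpair
  refine MvPolynomial.aeval_update_ne_zero_of_irreducible hG hj hdeg c
    (algebraicIndependent_comp_subtype.1 hind _
      (MvPolynomial.aeval_update_mem_supported G i c) ?_)
  rw [← hz, ← AlgHom.comp_apply]
  congr 1
  refine MvPolynomial.algHom_ext fun m ↦ ?_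
  rcases eq_or_ne m i with rfl | hm
  · simp
  · simp [Function.update_of_ne hm]

/-- An algebraic relation between finitely many elements persists when they are replaced by
elements algebraic over them. -/
theorem not_algebraicIndependent_of_forall_mem_closure {ι : Type*} [Finite ι] {z w : ι → A}
    (hz : ¬ AlgebraicIndependent k z)
    (hw : ∀ i, w i ∈ (matroid k A).closure (Set.range z)) :
    ¬ AlgebraicIndependent k w := by
  intro hwi
  have hindep : (matroid k A).Indep (Set.range w) := hwi.coe_range
  have hle : (Set.range w).encard ≤ (matroid k A).eRk (Set.range z) := by
    rw [← hindep.eRk_eq_encard, ← Matroid.eRk_closure_eq _ (Set.range z)]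
    exact Matroid.eRk_mono _ (Set.range_subset_iff.2 hw)
  have hcard : (Set.range w).encard = ENat.card ι := by
    rw [← Set.image_univ, hwi.injective.injOn.encard_image, Set.encard_univ]
  have hzle : (Set.range z).encard ≤ ENat.card ι := by
    rw [← Set.image_univ, ← Set.encard_univ]
    exact Set.encard_image_le _ _
  have hfin : (Set.range z).Finite := Set.finite_range z
  have hzi : (matroid k A).Indep (Set.range z) :=
    (Matroid.indep_iff_eRk_eq_encard_of_finite hfin).2
      (le_antisymm (Matroid.eRk_le_encard _ _) (hzle.trans (hcard ▸ hle)))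
  have hinj : Function.Injective z := by
    have : (Set.univ : Set ι).encard = (z '' Set.univ).encard := by
      rw [Set.image_univ, Set.encard_univ]
      exact le_antisymm ((hcard ▸ hle).trans (Matroid.eRk_le_encard _ _)) hzle
    exact Set.injOn_univ.1 (Set.finite_univ.injOn_of_encard_image_eq this.symm)
  exact hz ((algebraicIndependent_subtype_range hinj).1 hzi)

/-- Over an algebraically closed field, the only algebraic elements of a domain are constants. -/
theorem IsAlgebraic.exists_algebraMap_eq [IsAlgClosed k] {a : A} (ha : IsAlgebraic k a) :
    ∃ c, algebraMap k A c = a := by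
  have : Algebra.IsIntegral k (Algebra.adjoin k {a}) :=
    Algebra.IsIntegral.adjoin fun x hx ↦ by
      rw [Set.mem_singleton_iff.1 hx]; exact ha.isIntegral
  obtain ⟨c, hc⟩ := (IsAlgClosed.algebraMap_bijective_of_isIntegral (k := k)).2
    (⟨a, Algebra.self_mem_adjoin_singleton k a⟩ : Algebra.adjoin k {a})
  exact ⟨c, congrArg Subtype.val hc⟩

end AlgebraicRelations

section AnalyticFunctions

variable {E : Type*} [NormedAddCommGroup E] [NormedSpace ℂ E]

/-- The algebra of complex functions on `U` that are analytic on a neighbourhood of `U`. -/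
noncomputable def analyticSubalgebra (U : Set E) : Subalgebra ℂ (U → ℂ) where
  carrier := {f | ∃ g : E → ℂ, AnalyticOnNhd ℂ g U ∧ ∀ u : U, g u = f u}
  mul_mem' := by
    rintro f₁ f₂ ⟨g₁, hg₁, h₁⟩ ⟨g₂, hg₂, h₂⟩
    exact ⟨g₁ * g₂, hg₁.mul hg₂, fun u ↦ by simp [h₁, h₂]⟩
  add_mem' := by
    rintro f₁ f₂ ⟨g₁, hg₁, h₁⟩ ⟨g₂, hg₂, h₂⟩
    exact ⟨g₁ + g₂, hg₁.add hg₂, fun u ↦ by simp [h₁, h₂]⟩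
  algebraMap_mem' c := ⟨fun _ ↦ c, analyticOnNhd_const, fun _ ↦ rfl⟩

theorem AnalyticOnNhd.eqOn_zero_or_eqOn_zero_of_mul {U : Set E} (hU : IsOpen U)
    (hc : IsPreconnected U) {f g : E → ℂ} (hf : AnalyticOnNhd ℂ f U) (hg : AnalyticOnNhd ℂ g U)
    (hfg : ∀ u ∈ U, f u * g u = 0) : Set.EqOn f 0 U ∨ Set.EqOn g 0 U := by
  by_contra! h
  obtain ⟨u, hu, hfu⟩ : ∃ u ∈ U, f u ≠ 0 := by
    simpa [Set.EqOn] using h.1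
  refine h.2 (hg.eqOn_zero_of_preconnected_of_eventuallyEq_zero hc hu ?_)
  filter_upwards [(hf u hu).continuousAt.eventually_ne hfu, hU.mem_nhds hu] with v hv hvU
  exact (mul_eq_zero.1 (hfg v hvU)).resolve_left hv

theorem analyticSubalgebra_isDomain {U : Set E} (hU : IsOpen U) (hc : IsConnected U) :
    IsDomain (analyticSubalgebra U) := by
  have : Nonempty U := hc.nonempty.to_subtype
  have : NoZeroDivisors (analyticSubalgebra U) := by
    refine ⟨fun {a b} hab ↦ ?_⟩
    obtain ⟨f, hf, hfa⟩ := a.2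
    obtain ⟨g, hg, hgb⟩ := b.2
    refine (hf.eqOn_zero_or_eqOn_zero_of_mul hU hc.isPreconnected hg ?_).imp ?_ ?_
    · intro u hu
      rw [hfa ⟨u, hu⟩, hgb ⟨u, hu⟩]
      exact congrFun (congrArg Subtype.val hab) ⟨u, hu⟩
    · exact fun h ↦ Subtype.ext (funext fun u ↦ (hfa u).symm.trans (h u.2))
    · exact fun h ↦ Subtype.ext (funext fun u ↦ (hgb u).symm.trans (h u.2))
  exact NoZeroDivisors.to_isDomain _

theorem analyticSubalgebra_aeval_apply {U : Set E} {σ : Type*} (z : σ → analyticSubalgebra U)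
    (p : MvPolynomial σ ℂ) (u : U) :
    (MvPolynomial.aeval z p).1 u = MvPolynomial.eval (fun i ↦ (z i).1 u) p := by
  let φ : analyticSubalgebra U →ₐ[ℂ] ℂ :=
    (Pi.evalAlgHom ℂ (fun _ : U ↦ ℂ) u).comp (analyticSubalgebra U).val
  change φ (MvPolynomial.aeval z p) = _
  rw [← AlgHom.comp_apply, MvPolynomial.comp_aeval, ← MvPolynomial.coe_aeval_eq_eval]
  rfl

/-- The pullback of an analytic function along a continuous linear form. -/
noncomputable def analyticPullback {U : Set E} {V : Set ℂ} {P : ℂ → ℂ} (hP : AnalyticOnNhd ℂ P V)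
    (φ : E →L[ℂ] ℂ) (hφ : Set.MapsTo φ U V) : analyticSubalgebra U :=
  ⟨fun u ↦ P (φ u), P ∘ φ, hP.comp (φ.analyticOnNhd U) hφ, fun _ ↦ rfl⟩

theorem transcendental_analyticPullback {U : Set E} [IsDomain (analyticSubalgebra U)]
    {V : Set ℂ} {P : ℂ → ℂ} (hP : AnalyticOnNhd ℂ P V) (hV : IsPreconnected V)
    (hPnc : ¬ ∃ c : ℂ, ∀ x ∈ V, P x = c) (hU : IsOpen U) (hUne : U.Nonempty)
    (φ : E →L[ℂ] ℂ) (hφ : Set.MapsTo φ U V) (hφs : Function.Surjective φ) :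
    Transcendental ℂ (analyticPullback hP φ hφ) := by
  intro halg
  obtain ⟨c, hc⟩ := halg.exists_algebraMap_eq
  obtain ⟨u, hu⟩ := hUne
  refine hPnc ⟨c, hP.eqOn_of_preconnected_of_eventuallyEq analyticOnNhd_const hV (hφ hu) ?_⟩
  have hopen : IsOpen (φ '' U) := φ.isOpenMap_of_finiteDimensional hφs U hU
  filter_upwards [hopen.mem_nhds ⟨u, hu, rfl⟩]
  rintro _ ⟨v, hv, rfl⟩
  exact (congrFun (congrArg Subtype.val hc) ⟨v, hv⟩).symm

end AnalyticFunctions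


/-- **Köbe's normalization (elimination step).**
If three nonconstant analytic elements `P₁, P₂, P₃` on the disk `|x| < r` satisfy an
irreducible algebraic addition relation `G (P₁ x, P₂ y, P₃ (x+y)) = 0` for
`|x|, |y| < r/2`, where `G` has positive degree in each variable, then there is a nonzero
polynomial relation `Gbar (P₁ x, P₁ y, P₁ (x+y)) = 0` involving the single element `P₁`,
valid on some smaller bidisk. -/
theorem koebe_normalization (r : ℝ) (hr : 0 < r) (P₁ P₂ P₃ : ℂ → ℂ)
    (hP₁ : AnalyticOnNhd ℂ P₁ (ball (0 : ℂ) r))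
    (hP₂ : AnalyticOnNhd ℂ P₂ (ball (0 : ℂ) r))
    (hP₃ : AnalyticOnNhd ℂ P₃ (ball (0 : ℂ) r))
    (hP₁nc : ¬ ∃ c : ℂ, ∀ x ∈ ball (0 : ℂ) r, P₁ x = c)
    (hP₂nc : ¬ ∃ c : ℂ, ∀ x ∈ ball (0 : ℂ) r, P₂ x = c)
    (hP₃nc : ¬ ∃ c : ℂ, ∀ x ∈ ball (0 : ℂ) r, P₃ x = c)
    (G : MvPolynomial (Fin 3) ℂ) (hGirr : Irreducible G)
    (hGdeg : ∀ i : Fin 3, 0 < G.degreeOf i)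
    (hG : ∀ x y : ℂ, ‖x‖ < r / 2 → ‖y‖ < r / 2 →
      MvPolynomial.eval ![P₁ x, P₂ y, P₃ (x + y)] G = 0) :
    ∃ Gbar : MvPolynomial (Fin 3) ℂ, Gbar ≠ 0 ∧ ∃ ρ : ℝ, 0 < ρ ∧
      ∀ x y : ℂ, ‖x‖ < ρ → ‖y‖ < ρ →
        MvPolynomial.eval ![P₁ x, P₁ y, P₁ (x + y)] Gbar = 0 := by
  let U : Set (ℂ × ℂ) := ball 0 (r / 4)
  have hUo : IsOpen U := isOpen_ball
  have hUc : IsConnected U :=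
    ⟨⟨0, mem_ball_self (by positivity)⟩, (convex_ball 0 (r / 4)).isPreconnected⟩
  have : IsDomain (analyticSubalgebra U) := analyticSubalgebra_isDomain hUo hUc
  have : FaithfulSMul ℂ (analyticSubalgebra U) :=
    (faithfulSMul_iff_algebraMap_injective _ _).2 (algebraMap ℂ (analyticSubalgebra U)).injective
  have hUmem (u : ℂ × ℂ) : u ∈ U ↔ ‖u.1‖ < r / 4 ∧ ‖u.2‖ < r / 4 := by
    simp [U, Prod.norm_def]
  let p : ℂ × ℂ →L[ℂ] ℂ := ContinuousLinearMap.fst ℂ ℂ ℂ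
  let q : ℂ × ℂ →L[ℂ] ℂ := ContinuousLinearMap.snd ℂ ℂ ℂ
  let s : ℂ × ℂ →L[ℂ] ℂ := p + q
  have hp (u) (hu : u ∈ U) : ‖p u‖ < r / 2 := ((hUmem u).1 hu).1.trans (by linarith)
  have hq (u) (hu : u ∈ U) : ‖q u‖ < r / 2 := ((hUmem u).1 hu).2.trans (by linarith)
  have hs (u) (hu : u ∈ U) : ‖s u‖ < r / 2 :=
    (norm_add_le u.1 u.2).trans_lt (by linarith [((hUmem u).1 hu).1, ((hUmem u).1 hu).2])
  have hball {φ : ℂ × ℂ →L[ℂ] ℂ} (h : ∀ u ∈ U, ‖φ u‖ < r / 2) :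
      Set.MapsTo φ U (ball 0 r) := fun u hu ↦ by
    rw [mem_ball_zero_iff]
    linarith [h u hu]
  have hqs : Function.Surjective q := Prod.snd_surjective
  have hss : Function.Surjective s := fun c ↦ ⟨(c, 0), by simp [s, p, q]⟩
  have hV : IsPreconnected (ball (0 : ℂ) r) := (convex_ball 0 r).isPreconnected
  let F₁ {φ : ℂ × ℂ →L[ℂ] ℂ} (h : ∀ u ∈ U, ‖φ u‖ < r / 2) := analyticPullback hP₁ φ (hball h)
  let F₂ {φ : ℂ × ℂ →L[ℂ] ℂ} (h : ∀ u ∈ U, ‖φ u‖ < r / 2) := analyticPullback hP₂ φ (hball h)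
  let F₃ {φ : ℂ × ℂ →L[ℂ] ℂ} (h : ∀ u ∈ U, ‖φ u‖ < r / 2) := analyticPullback hP₃ φ (hball h)
  let M := AlgebraicIndependent.matroid ℂ (analyticSubalgebra U)
  have h0 : ‖(0 : ℂ)‖ < r / 2 := by simpa using hr
  have h02 : ({1}ᶜ : Set (Fin 3)) = {0, 2} := by
    ext m
    fin_cases m <;> simp
  have h21 : ({0}ᶜ : Set (Fin 3)) = {2, 1} := by
    ext m
    fin_cases m <;> simp
  have h₁₃ {φ : ℂ × ℂ →L[ℂ] ℂ} (h : ∀ u ∈ U, ‖φ u‖ < r / 2) (hφ : Function.Surjective φ) :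
      F₁ h ∈ M.closure {F₃ h} := by
    refine mem_matroid_closure_singleton_of_aeval_update hGirr (i := 1) (j := 0) (l := 2)
      (by decide) (hGdeg 0) h02 ![F₁ h, 0, F₃ h] (P₂ 0) ?_
      (transcendental_analyticPullback hP₃ hV hP₃nc hUo hUc.nonempty φ (hball h) hφ)
    refine Subtype.ext (funext fun u ↦ ?_)
    rw [analyticSubalgebra_aeval_apply]
    refine Eq.trans ?_ (hG (φ u) 0 (h u u.2) h0)
    congr 2
    funext m
    fin_cases m <;> simp [F₁, F₃, analyticPullback, Pi.algebraMap_apply]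
  have h₃₂ {φ : ℂ × ℂ →L[ℂ] ℂ} (h : ∀ u ∈ U, ‖φ u‖ < r / 2) (hφ : Function.Surjective φ) :
      F₃ h ∈ M.closure {F₂ h} := by
    refine mem_matroid_closure_singleton_of_aeval_update hGirr (i := 0) (j := 2) (l := 1)
      (by decide) (hGdeg 2) h21 ![0, F₂ h, F₃ h] (P₁ 0) ?_
      (transcendental_analyticPullback hP₂ hV hP₂nc hUo hUc.nonempty φ (hball h) hφ)
    refine Subtype.ext (funext fun u ↦ ?_)
    rw [analyticSubalgebra_aeval_apply]
    refine Eq.trans ?_ (hG 0 (φ u) h0 (h u u.2))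
    congr 2
    funext m
    fin_cases m <;> simp [F₂, F₃, analyticPullback, Pi.algebraMap_apply]
  have hz : ¬ AlgebraicIndependent ℂ ![F₁ hp, F₂ hq, F₃ hs] := fun hind ↦ by
    refine hGirr.ne_zero (hind.eq_zero_of_aeval_eq_zero G (Subtype.ext (funext fun u ↦ ?_)))
    rw [analyticSubalgebra_aeval_apply]
    refine Eq.trans ?_ (hG (p u) (q u) (hp u u.2) (hq u u.2))
    congr 2
    funext m
    fin_cases m <;> rfl
  have hw : ¬ AlgebraicIndependent ℂ ![F₁ hp, F₁ hq, F₁ hs] := by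
    refine not_algebraicIndependent_of_forall_mem_closure hz fun m ↦ ?_
    have hsub (i) : M.closure {![F₁ hp, F₂ hq, F₃ hs] i} ⊆
        M.closure (Set.range ![F₁ hp, F₂ hq, F₃ hs]) :=
      M.closure_subset_closure (Set.singleton_subset_iff.2 (Set.mem_range_self i))
    fin_cases m
    · exact hsub 0 (M.mem_closure_of_mem (Set.mem_singleton _) (Set.subset_univ _))
    · exact hsub 1 (M.closure_subset_closure_of_subset_closure
        (Set.singleton_subset_iff.2 (h₃₂ hq hqs)) (h₁₃ hq hqs))
    · exact hsub 2 (h₁₃ hs hss)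
  rw [algebraicIndependent_iff] at hw
  push Not at hw
  obtain ⟨H, hH, hH0⟩ := hw
  refine ⟨H, hH0, r / 4, by positivity, fun x y hx hy ↦ ?_⟩
  have hxy := congrFun (congrArg Subtype.val hH) ⟨(x, y), (hUmem _).2 ⟨hx, hy⟩⟩
  rw [analyticSubalgebra_aeval_apply] at hxy
  refine Eq.trans ?_ hxy
  congr 2
  funext m
  fin_cases m <;> rfl
end

section
/- Let ρ > 0 and let P be analytic and nonconstant on the disk D(0,ρ) = {u : |u| < ρ}. Let G ∈ ℂ[X,Y,Z] be an irreducible polynomial which is not a scalar multiple of X - Y, and suppose G(P(u), P(v), P(u+v)) = 0 for all u, v with |u| < ρ/2 and |v| < ρ/2. Then for every R > 0 there exist an integer N ≥ 1 and functions p_0, p_1, …, p_N analytic on the disk D(0,R), not all identically zero, such that p_0(u) P(u)^N + p_1(u) P(u)^{N-1} + ⋯ + p_N(u) = 0 for all u with |u| < min(ρ, R). -/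
open Metric

open Polynomial in
/-- If `g` satisfies a nontrivial polynomial relation over `k[f]`, with `f` transcendental
over `k` and algebraic over a subalgebra `B`, then `g` is algebraic over `B`. -/
theorem IsAlgebraic.of_eval₂_aeval_eq_zero {k A : Type*} [Field k] [CommRing A] [IsDomain A]
    [Algebra k A] {B : Subalgebra k A} {f g : A} (hf : IsAlgebraic B f)
    (hft : Transcendental k f) {H : k[X][X]} (hH : H ≠ 0)
    (h : H.eval₂ (aeval f : k[X] →ₐ[k] A).toRingHom g = 0) : IsAlgebraic B g := by
  let S := Subalgebra.algebraicClosure B A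
  let f' : S := ⟨f, hf⟩
  let φ : k[X] →+* S := (aeval f' : k[X] →ₐ[k] S).toRingHom
  have hcomp : (algebraMap S A).comp φ = (aeval f : k[X] →ₐ[k] A).toRingHom := by
    ext a
    · simp [φ]
    · simp [φ]
      rfl
  have hinj : Function.Injective φ := by
    have : Function.Injective (aeval f : k[X] →ₐ[k] A).toRingHom :=
      transcendental_iff_injective.mp hft
    rw [← hcomp, RingHom.coe_comp] at this
    exact Function.Injective.of_comp this
  have : IsAlgebraic S g :=
    ⟨H.map φ, (Polynomial.map_ne_zero_iff hinj).mpr hH, by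
      rw [aeval_def, eval₂_map, hcomp, h]⟩
  exact this.restrictScalars B

open MvPolynomial in
/-- An irreducible polynomial vanishing identically on the plane `X₀ = X₁` is a scalar multiple
of `X₀ - X₁`. -/
theorem MvPolynomial.exists_eq_C_mul_X_sub_X_of_irreducible {k : Type*} [Field k]
    {G : MvPolynomial (Fin 3) k} (hG : Irreducible G)
    (h : aeval ![Polynomial.C (Polynomial.X : Polynomial k), Polynomial.C Polynomial.X,
      Polynomial.X] G = 0) : ∃ c : k, G = C c * (X 0 - X 1) := by
  set I : Ideal (MvPolynomial (Fin 3) k) := Ideal.span {X 0 - X 1} with hI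
  have h01 : Ideal.Quotient.mk I (X 0) = Ideal.Quotient.mk I (X 1) := by
    rw [Ideal.Quotient.eq]
    exact Ideal.subset_span rfl
  let s : Polynomial (Polynomial k) →+* MvPolynomial (Fin 3) k ⧸ I :=
    Polynomial.eval₂RingHom
      (Polynomial.aeval (Ideal.Quotient.mk I (X 1)) : Polynomial k →ₐ[k] _).toRingHom
      (Ideal.Quotient.mk I (X 2))
  have hs : s.comp (aeval ![Polynomial.C (Polynomial.X : Polynomial k), Polynomial.C Polynomial.X,
      Polynomial.X] : MvPolynomial (Fin 3) k →ₐ[k] _).toRingHom = Ideal.Quotient.mk I := by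
    apply MvPolynomial.ringHom_ext
    · intro r
      simp [s, Polynomial.algebraMap_apply]
      rfl
    · intro i
      fin_cases i <;> simp [s, h01]
  have hmem : X 0 - X 1 ∣ G := by
    rw [← Ideal.mem_span_singleton, ← hI, ← Ideal.Quotient.eq_zero_iff_mem, ← hs]
    simp [h]
  obtain ⟨q, hq⟩ := hmem
  rcases hG.isUnit_or_isUnit hq with hu | hu
  · simpa using hu.map (eval (fun _ : Fin 3 ↦ (0 : k)))
  · obtain ⟨c, -, rfl⟩ := MvPolynomial.isUnit_iff_eq_C_of_isReduced.mp hu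
    exact ⟨c, by rw [hq, mul_comm]⟩

/-- The functions on `ball 0 r` which are restrictions of functions analytic on `ball 0 R`. -/
def analyticRestrict (r R : ℝ) : Subalgebra ℂ (ball (0 : ℂ) r → ℂ) where
  carrier := {g | ∃ F : ℂ → ℂ, AnalyticOnNhd ℂ F (ball 0 R) ∧ ∀ u, g u = F u}
  mul_mem' := by
    rintro a b ⟨F, hF, ha⟩ ⟨F', hF', hb⟩
    exact ⟨_, hF.mul hF', fun u ↦ by simp [ha, hb]⟩
  add_mem' := by
    rintro a b ⟨F, hF, ha⟩ ⟨F', hF', hb⟩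
    exact ⟨_, hF.add hF', fun u ↦ by simp [ha, hb]⟩
  algebraMap_mem' c := ⟨fun _ ↦ c, analyticOnNhd_const, fun _ ↦ rfl⟩

/-- Identity theorem for concentric disks. -/
theorem AnalyticOnNhd.eqOn_ball_of_eqOn_ball {r R : ℝ} (hr : 0 < r) {F F' : ℂ → ℂ}
    (hF : AnalyticOnNhd ℂ F (ball 0 R)) (hF' : AnalyticOnNhd ℂ F' (ball 0 R))
    (h : Set.EqOn F F' (ball 0 r)) : Set.EqOn F F' (ball 0 R) := by
  intro u hu
  have hR : 0 < R := (norm_nonneg u).trans_lt (by simpa using hu)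
  exact hF.eqOn_of_preconnected_of_eventuallyEq hF' (convex_ball 0 R).isPreconnected
    (mem_ball_self hR) (Filter.eventuallyEq_of_mem (ball_mem_nhds 0 hr) h) hu

theorem isDomain_analyticRestrict {r : ℝ} (hr : 0 < r) : IsDomain (analyticRestrict r r) := by
  have : Nonempty (ball (0 : ℂ) r) := ⟨⟨0, mem_ball_self hr⟩⟩
  have : NoZeroDivisors (analyticRestrict r r) := by
    refine ⟨fun {a b} hab ↦ ?_⟩
    obtain ⟨F, hF, ha⟩ := a.2
    obtain ⟨F', hF', hb⟩ := b.2
    have key := hF.eq_zero_or_eq_zero_of_smul_eq_zero hF' (fun u hu ↦ by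
      have := congrFun (congrArg Subtype.val hab) ⟨u, hu⟩
      simpa [ha, hb] using this) (convex_ball 0 r).isPreconnected
    refine key.imp (fun h ↦ ?_) (fun h ↦ ?_)
    · ext u
      simpa [ha] using h u u.2
    · ext u
      simpa [hb] using h u u.2
  exact NoZeroDivisors.to_isDomain _

open Polynomial in
/-- Algebraicity over the ring of restrictions, as an equation with analytic coefficients. -/
theorem isAlgebraic_analyticRestrict_iff {r R : ℝ} (hr : 0 < r) (hrR : r ≤ R) {f : ℂ → ℂ}
    {g : analyticRestrict r r} (hg : ∀ u, g.1 u = f u) :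
    IsAlgebraic ((analyticRestrict r R).comap (analyticRestrict r r).val) g ↔
      ∃ N : ℕ, 1 ≤ N ∧ ∃ p : Fin (N + 1) → ℂ → ℂ,
      (∀ i, AnalyticOnNhd ℂ (p i) (ball (0 : ℂ) R)) ∧
      (∃ i, ∃ u ∈ ball (0 : ℂ) R, p i u ≠ 0) ∧
      ∀ u : ℂ, ‖u‖ < r → ∑ i : Fin (N + 1), p i u * f u ^ (N - (i : ℕ)) = 0 := by
  have := isDomain_analyticRestrict hr
  constructor
  · rintro ⟨q, hq, hq0⟩
    have hlift (n : ℕ) : ∃ F : ℂ → ℂ, AnalyticOnNhd ℂ F (ball 0 R) ∧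
        ∀ u, (q.coeff n : analyticRestrict r r).1 u = F u := (q.coeff n).2
    choose F hF hqF using hlift
    refine ⟨q.natDegree, natDegree_pos_of_aeval_root hq hq0 fun x hx ↦ by simpa using hx,
      fun i ↦ F (q.natDegree - i), fun i ↦ hF _, ⟨0, ?_⟩, fun u hu ↦ ?_⟩
    · by_contra! hcon
      refine hq (leadingCoeff_eq_zero.mp (Subtype.ext (Subtype.ext (funext fun u ↦ ?_))))
      exact (hqF _ u).trans (hcon u (ball_subset_ball hrR u.2))
    · have h := congrFun (congrArg Subtype.val hq0) ⟨u, by simpa using hu⟩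
      rw [Fin.sum_univ_eq_sum_range (fun i ↦ F (q.natDegree - i) u * f u ^ (q.natDegree - i))]
      rw [aeval_eq_sum_range, ← Finset.sum_range_reflect] at h
      simpa [Algebra.smul_def, hg, hqF] using h
  · rintro ⟨N, -, p, hp, ⟨i, u, hu, hne⟩, h⟩
    let c (i : Fin (N + 1)) : (analyticRestrict r R).comap (analyticRestrict r r).val :=
      ⟨⟨fun u ↦ p i u, ⟨p i, (hp i).mono (ball_subset_ball hrR), fun _ ↦ rfl⟩⟩,
        ⟨p i, hp i, fun _ ↦ rfl⟩⟩
    refine ⟨∑ i : Fin (N + 1), monomial (N - (i : ℕ)) (c i), fun h0 ↦ hne ?_, ?_⟩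
    · have hc : c i = 0 := by
        have := congrArg (fun q ↦ coeff q (N - (i : ℕ))) h0
        simp only [finsetSum_coeff, coeff_monomial, coeff_zero] at this
        rw [Finset.sum_eq_single i] at this
        · simpa using this
        · intro b _ hb
          rw [if_neg]
          omega
        · simp
      refine (hp i).eqOn_ball_of_eqOn_ball hr (F' := fun _ ↦ 0) analyticOnNhd_const
        (fun v hv ↦ ?_) hu
      exact congrFun (congrArg Subtype.val (congrArg Subtype.val hc)) ⟨v, hv⟩
    · refine Subtype.ext (funext fun u ↦ ?_)
      simpa [aeval_monomial, hg, c] using! h u (mem_ball_zero_iff.mp u.2)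

theorem transcendental_analyticRestrict {r : ℝ} (hr : 0 < r) {g : analyticRestrict r r}
    (hg : ¬ ∃ c : ℂ, ∀ u, g.1 u = c) : Transcendental ℂ g := by
  have := isDomain_analyticRestrict hr
  intro halg
  refine hg ?_
  obtain ⟨c, hc⟩ := minpoly.mem_range_of_degree_eq_one ℂ g
    (IsAlgClosed.degree_eq_one_of_irreducible ℂ (minpoly.irreducible halg.isIntegral))
  exact ⟨c, fun u ↦ by rw [← hc]; rfl⟩

theorem MvPolynomial.val_aeval_analyticRestrict {r R : ℝ} {σ : Type*}
    (x : σ → analyticRestrict r R) (G : MvPolynomial σ ℂ) (u : ball (0 : ℂ) r) :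
    (aeval x G).1 u = eval (fun i ↦ (x i).1 u) G := by
  have := MvPolynomial.comp_aeval_apply (R := ℂ) (f := x)
    ((Pi.evalAlgHom ℂ (fun _ ↦ ℂ) u).comp (analyticRestrict r R).val) G
  simpa [MvPolynomial.aeval_eq_eval] using this

/-- The doubling step: an equation for `P` over the disk of radius `R / 2` gives one over the disk
of radius `R`. -/
theorem exists_algebroid_equation_double {ρ R : ℝ} (hρ : 0 < ρ) (hR : 0 < R) {P : ℂ → ℂ}
    (hP : AnalyticOnNhd ℂ P (ball (0 : ℂ) ρ))
    (hPnc : ¬ ∃ c : ℂ, ∀ u ∈ ball (0 : ℂ) ρ, P u = c)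
    {G : MvPolynomial (Fin 3) ℂ} (hGirr : Irreducible G)
    (hGne : ¬ ∃ c : ℂ, G = MvPolynomial.C c * (MvPolynomial.X 0 - MvPolynomial.X 1))
    (hG : ∀ u v : ℂ, ‖u‖ < ρ / 2 → ‖v‖ < ρ / 2 →
      MvPolynomial.eval ![P u, P v, P (u + v)] G = 0)
    (h : ∃ N : ℕ, 1 ≤ N ∧ ∃ p : Fin (N + 1) → ℂ → ℂ,
      (∀ i, AnalyticOnNhd ℂ (p i) (ball (0 : ℂ) (R / 2))) ∧
      (∃ i, ∃ u ∈ ball (0 : ℂ) (R / 2), p i u ≠ 0) ∧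
      ∀ u : ℂ, ‖u‖ < min ρ (R / 2) →
        ∑ i : Fin (N + 1), p i u * P u ^ (N - (i : ℕ)) = 0) :
    ∃ N : ℕ, 1 ≤ N ∧ ∃ p : Fin (N + 1) → ℂ → ℂ,
      (∀ i, AnalyticOnNhd ℂ (p i) (ball (0 : ℂ) R)) ∧
      (∃ i, ∃ u ∈ ball (0 : ℂ) R, p i u ≠ 0) ∧
      ∀ u : ℂ, ‖u‖ < min ρ R →
        ∑ i : Fin (N + 1), p i u * P u ^ (N - (i : ℕ)) = 0 := by
  set r := min ρ R with hr_def
  have hr : 0 < r := lt_min hρ hR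
  have hrρ : r ≤ ρ := min_le_left _ _
  have hrR : r ≤ R := min_le_right _ _
  have := isDomain_analyticRestrict hr
  have hnorm (u : ℂ) : ‖u / 2‖ = ‖u‖ / 2 := by simp
  have hhalf {F : ℂ → ℂ} {s t : ℝ} (hst : t / 2 ≤ s) (hF : AnalyticOnNhd ℂ F (ball 0 s)) :
      AnalyticOnNhd ℂ (fun u ↦ F (u / 2)) (ball 0 t) := by
    refine hF.comp (g := F) (f := fun u : ℂ ↦ u / 2)
      (fun u _ ↦ by fun_prop (disch := norm_num)) fun u hu ↦ ?_
    rw [mem_ball_zero_iff] at hu ⊢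
    rw [hnorm]
    linarith
  let f : analyticRestrict r r :=
    ⟨fun u ↦ P (u / 2), fun u ↦ P (u / 2), hhalf (by linarith) hP, fun _ ↦ rfl⟩
  let g : analyticRestrict r r :=
    ⟨fun u ↦ P u, P, hP.mono (ball_subset_ball hrρ), fun _ ↦ rfl⟩
  have hf : IsAlgebraic ((analyticRestrict r R).comap (analyticRestrict r r).val) f := by
    rw [isAlgebraic_analyticRestrict_iff hr hrR (f := fun u ↦ P (u / 2)) fun _ ↦ rfl]
    obtain ⟨N, hN, p, hp, ⟨i, u, hu, hne⟩, heq⟩ := h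
    refine ⟨N, hN, fun i u ↦ p i (u / 2), fun i ↦ hhalf le_rfl (hp i),
      ⟨i, 2 * u, ?_, by simpa using hne⟩, fun u hu ↦ heq _ ?_⟩
    · rw [mem_ball_zero_iff] at hu ⊢
      rw [norm_mul, Complex.norm_ofNat]
      linarith
    · rw [hnorm]
      exact lt_min (by linarith) (by linarith)
  have hft : Transcendental ℂ f := by
    refine transcendental_analyticRestrict hr fun ⟨c, hc⟩ ↦ hPnc ⟨c, ?_⟩
    refine hP.eqOn_ball_of_eqOn_ball (half_pos hr) (F' := fun _ ↦ c) analyticOnNhd_const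
      fun u hu ↦ ?_
    have hu' : 2 * u ∈ ball (0 : ℂ) r := by
      rw [mem_ball_zero_iff] at hu ⊢
      rw [norm_mul, Complex.norm_ofNat]
      linarith
    simpa [f] using hc ⟨2 * u, hu'⟩
  refine (isAlgebraic_analyticRestrict_iff hr hrR (g := g) fun _ ↦ rfl).mp
    (hf.of_eval₂_aeval_eq_zero hft
      (mt (MvPolynomial.exists_eq_C_mul_X_sub_X_of_irreducible hGirr) hGne) ?_)
  have hcomp : (Polynomial.eval₂RingHom
      (Polynomial.aeval f : Polynomial ℂ →ₐ[ℂ] analyticRestrict r r).toRingHom g).comp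
      (MvPolynomial.aeval ![Polynomial.C (Polynomial.X : Polynomial ℂ),
        Polynomial.C Polynomial.X, Polynomial.X] :
          MvPolynomial (Fin 3) ℂ →ₐ[ℂ] _).toRingHom =
      (MvPolynomial.aeval ![f, f, g] : MvPolynomial (Fin 3) ℂ →ₐ[ℂ] _).toRingHom := by
    apply MvPolynomial.ringHom_ext
    · intro c
      simp [Polynomial.algebraMap_apply]
    · intro i
      fin_cases i <;> simp
  refine (RingHom.congr_fun hcomp G).trans (Subtype.ext (funext fun u ↦ ?_))
  have hu : ‖(u : ℂ) / 2‖ < ρ / 2 := by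
    have := mem_ball_zero_iff.mp u.2
    rw [hnorm]
    linarith
  have hvec : (fun i ↦ ((![f, f, g] : Fin 3 → analyticRestrict r r) i).1 u) =
      ![P (u / 2), P (u / 2), P ((u : ℂ) / 2 + u / 2)] := by
    ext i
    fin_cases i <;> simp [f, g]
  exact (MvPolynomial.val_aeval_analyticRestrict _ G u).trans (hvec ▸ hG _ _ hu hu)

/-- **A function element with an algebraic addition theorem is algebroid in every
bounded domain.** If `P` is analytic and nonconstant on `|u| < ρ` and satisfies an
algebraic addition theorem `G (P u, P v, P (u+v)) = 0` for `|u|, |v| < ρ/2`, with `G`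
irreducible and not a scalar multiple of `X - Y`, then for every `R > 0` the function `P`
satisfies, on `|u| < min ρ R`, a polynomial equation whose coefficients are analytic on
the disk `|u| < R` and not all identically zero. -/
theorem AAT_element_algebroid (ρ : ℝ) (hρ : 0 < ρ) (P : ℂ → ℂ)
    (hP : AnalyticOnNhd ℂ P (ball (0 : ℂ) ρ))
    (hPnc : ¬ ∃ c : ℂ, ∀ u ∈ ball (0 : ℂ) ρ, P u = c)
    (G : MvPolynomial (Fin 3) ℂ) (hGirr : Irreducible G)
    (hGne : ¬ ∃ c : ℂ, G = MvPolynomial.C c * (MvPolynomial.X 0 - MvPolynomial.X 1))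
    (hG : ∀ u v : ℂ, ‖u‖ < ρ / 2 → ‖v‖ < ρ / 2 →
      MvPolynomial.eval ![P u, P v, P (u + v)] G = 0) :
    ∀ R : ℝ, 0 < R → ∃ N : ℕ, 1 ≤ N ∧ ∃ p : Fin (N + 1) → ℂ → ℂ,
      (∀ i, AnalyticOnNhd ℂ (p i) (ball (0 : ℂ) R)) ∧
      (∃ i, ∃ u ∈ ball (0 : ℂ) R, p i u ≠ 0) ∧
      ∀ u : ℂ, ‖u‖ < min ρ R →
        ∑ i : Fin (N + 1), p i u * P u ^ (N - (i : ℕ)) = 0 := by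
  have key (n : ℕ) : ∀ R : ℝ, 0 < R → R ≤ 2 ^ n * ρ →
      ∃ N : ℕ, 1 ≤ N ∧ ∃ p : Fin (N + 1) → ℂ → ℂ,
      (∀ i, AnalyticOnNhd ℂ (p i) (ball (0 : ℂ) R)) ∧
      (∃ i, ∃ u ∈ ball (0 : ℂ) R, p i u ≠ 0) ∧
      ∀ u : ℂ, ‖u‖ < min ρ R →
        ∑ i : Fin (N + 1), p i u * P u ^ (N - (i : ℕ)) = 0 := by
    induction n with
    | zero =>
      intro R hR hle
      refine ⟨1, le_rfl, ![fun _ ↦ 1, fun u ↦ -P u], fun i ↦ ?_,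
        ⟨0, 0, mem_ball_self hR, by simp⟩, fun u _ ↦ by simp [Fin.sum_univ_two]⟩
      fin_cases i
      · exact analyticOnNhd_const
      · exact (hP.mono (ball_subset_ball (by simpa using hle))).neg
    | succ n ih =>
      intro R hR hle
      refine exists_algebroid_equation_double hρ hR hP hPnc hGirr hGne hG
        (ih _ (half_pos hR) ?_)
      rw [pow_succ] at hle
      linarith
  intro R hR
  obtain ⟨n, hn⟩ := pow_unbounded_of_one_lt (R / ρ) one_lt_two
  exact key n R hR ((div_lt_iff₀ hρ).mp hn).le
end

section
/- Let φ, ψ : ℂ → ℂ be entire functions with φ nonconstant. Suppose (a) φ admits an algebraic addition theorem: there is a nonzero polynomial G ∈ ℂ[X,Y,Z] with G(φ(u), φ(v), φ(u+v)) = 0 for all u, v ∈ ℂ; and (b) ψ is algebraic over φ: there is a polynomial H ∈ ℂ[X,Y] of positive degree in Y with H(φ(u), ψ(u)) = 0 for all u ∈ ℂ. Then ψ admits an algebraic addition theorem: there exists a nonzero polynomial g ∈ ℂ[X,Y,Z] such that g(ψ(u), ψ(v), ψ(u+v)) = 0 for all u, v ∈ ℂ. -/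
open MvPolynomial in
/-- Over a transcendental `x`, a zero `y` of a nonzero bivariate polynomial relation with `x` is in
the closure of `x` in the algebraic independence matroid. -/
theorem mem_matroid_closure_singleton_of_aeval_eq_zero {R A : Type*} [CommRing R] [CommRing A]
    [IsDomain A] [Algebra R A] [FaithfulSMul R A] {x y : A} (hx : Transcendental R x)
    {p : MvPolynomial (Fin 2) R} (hp : p ≠ 0) (hxy : aeval ![x, y] p = 0) :
    y ∈ (AlgebraicIndependent.matroid R A).closure {x} := by
  have hindep : (AlgebraicIndependent.matroid R A).Indep {x} :=
    AlgebraicIndependent.matroid_indep_iff.2 <|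
      (algebraicIndependent_singleton_iff (⟨x, rfl⟩ : ({x} : Set A))).2 hx
  by_contra hy
  obtain ⟨hyx, hne⟩ := (hindep.notMem_closure_iff (Set.mem_univ y)).1 hy
  rw [Set.mem_singleton_iff] at hne
  have hinj : Function.Injective ![x, y] := by
    intro i j
    fin_cases i <;> fin_cases j <;> simp [hne, Ne.symm hne]
  have hrange : Set.range ![x, y] = {y, x} := by
    rw [Matrix.range_cons, Matrix.range_cons, Matrix.range_empty, Set.union_empty]
    exact Set.pair_comm x y
  rw [← hrange] at hyx
  exact hp (algebraicIndependent_iff.1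
    (AlgebraicIndependent.of_subtype_range hinj hyx) p hxy)

/-- If every member of a finite family is algebraic over the corresponding member of another family
and the former family is algebraically independent, then so is the latter. -/
theorem AlgebraicIndependent.of_mem_matroid_closure {R A ι : Type*} [CommRing R] [CommRing A]
    [IsDomain A] [Algebra R A] [FaithfulSMul R A] [Finite ι] {x y : ι → A}
    (hy : AlgebraicIndependent R y)
    (hxy : ∀ i, y i ∈ (AlgebraicIndependent.matroid R A).closure {x i}) :
    AlgebraicIndependent R x := by
  set M := AlgebraicIndependent.matroid R A
  have : Nontrivial R := (algebraMap R A).domain_nontrivial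
  have hsub : Set.range y ⊆ M.closure (Set.range x) := by
    rintro _ ⟨i, rfl⟩
    exact M.closure_subset_closure (Set.singleton_subset_iff.2 (Set.mem_range_self i)) (hxy i)
  have hyM : M.Indep (Set.range y) := hy.coe_range
  have hcard : ENat.card ι ≤ M.eRk (Set.range x) := by
    refine hy.injective.encard_range.trans ?_
    rw [← hyM.eRk_eq_encard, ← M.eRk_closure_eq (Set.range x)]
    exact M.eRk_mono hsub
  have hle : (Set.range x).encard ≤ ENat.card ι := by
    rw [← Set.image_univ, ← Set.encard_univ]
    exact Set.encard_image_le _ _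
  have hxM : M.Indep (Set.range x) :=
    (Matroid.indep_iff_eRk_eq_encard_of_finite (Set.finite_range x)).2
      ((M.eRk_le_encard _).antisymm (hle.trans hcard))
  have hinj : Function.Injective x := by
    rw [← Set.injOn_univ]
    apply Set.finite_univ.injOn_of_encard_image_eq
    rw [Set.image_univ, Set.encard_univ]
    exact hle.antisymm (hcard.trans (M.eRk_le_encard _))
  exact AlgebraicIndependent.of_subtype_range hinj hxM

/-- Over an algebraically closed field, an element of a domain that is not a scalar is
transcendental. -/
theorem IsAlgClosed.transcendental_of_notMem_range {k A : Type*} [Field k] [IsAlgClosed k]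
    [CommRing A] [IsDomain A] [Algebra k A] {x : A} (hx : x ∉ Set.range (algebraMap k A)) :
    Transcendental k x := by
  intro halg
  exact hx (minpoly.mem_range_of_degree_eq_one k x
    (IsAlgClosed.degree_eq_one_of_irreducible k (minpoly.irreducible halg.isIntegral)))

/-- The algebra of entire functions on a complex normed space. -/
def entireFunctions (E : Type*) [NormedAddCommGroup E] [NormedSpace ℂ E] :
    Subalgebra ℂ (E → ℂ) where
  carrier := {f | Differentiable ℂ f}
  mul_mem' hf hg := Differentiable.mul hf hg
  add_mem' hf hg := Differentiable.add hf hg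
  algebraMap_mem' c := differentiable_const c

namespace entireFunctions

variable {E : Type*} [NormedAddCommGroup E] [NormedSpace ℂ E]

instance : IsDomain (entireFunctions E) := by
  have : NoZeroDivisors (entireFunctions E) := by
    refine ⟨fun {f g} hfg ↦ ?_⟩
    by_contra! h
    obtain ⟨p, hp⟩ : ∃ p, f.1 p ≠ 0 := by
      by_contra! hf
      exact h.1 (Subtype.ext (funext hf))
    obtain ⟨q, hq⟩ : ∃ q, g.1 q ≠ 0 := by
      by_contra! hg
      exact h.2 (Subtype.ext (funext hg))
    have hline : Differentiable ℂ fun t : ℂ ↦ p + t • (q - p) := by fun_prop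
    have hana {f : E → ℂ} (hf : Differentiable ℂ f) :
        AnalyticOnNhd ℂ (fun t : ℂ ↦ f (p + t • (q - p))) Set.univ :=
      (hf.comp hline).differentiableOn.analyticOnNhd isOpen_univ
    rcases (hana f.2).eq_zero_or_eq_zero_of_smul_eq_zero (hana g.2)
      (fun t _ ↦ congrFun (congrArg Subtype.val hfg) (p + t • (q - p)))
      isPreconnected_univ with h0 | h0
    · exact hp (by simpa using h0 0 trivial)
    · exact hq (by simpa using h0 1 trivial)
  exact NoZeroDivisors.to_isDomain _

/-- Evaluation of an entire function at a point. -/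
noncomputable def evalAt (z : E) : entireFunctions E →ₐ[ℂ] ℂ :=
  (Pi.evalAlgHom ℂ (fun _ : E ↦ ℂ) z).comp (entireFunctions E).val

theorem aeval_eq_zero_iff {σ : Type*} (F : σ → entireFunctions E) (p : MvPolynomial σ ℂ) :
    MvPolynomial.aeval F p = 0 ↔ ∀ z, MvPolynomial.eval (fun i ↦ (F i).1 z) p = 0 := by
  have key (z : E) : (MvPolynomial.aeval F p).1 z = MvPolynomial.eval (fun i ↦ (F i).1 z) p := by
    rw [← MvPolynomial.aeval_eq_eval]
    exact MvPolynomial.comp_aeval_apply F (evalAt z) p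
  simp_rw [← key]
  exact ⟨fun h z ↦ by rw [h]; rfl, fun h ↦ Subtype.ext (funext h)⟩

/-- The pullback of an entire function of one variable along a continuous linear form. -/
noncomputable def comp {f : ℂ → ℂ} (hf : Differentiable ℂ f) (L : E →L[ℂ] ℂ) : entireFunctions E :=
  ⟨fun z ↦ f (L z), hf.comp L.differentiable⟩

theorem transcendental_comp {f : ℂ → ℂ} (hf : Differentiable ℂ f)
    (hnc : ¬ ∃ c, ∀ u, f u = c) {L : E →L[ℂ] ℂ} (hL : Function.Surjective L) :
    Transcendental ℂ (comp hf L) := by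
  apply IsAlgClosed.transcendental_of_notMem_range
  rintro ⟨c, hc⟩
  refine hnc ⟨c, fun u ↦ ?_⟩
  obtain ⟨z, rfl⟩ := hL u
  exact (congrFun (congrArg Subtype.val hc) z).symm

end entireFunctions

/-- **Schwarz's elimination step: the AAT transfers along algebraic dependence.**
Let `φ, ψ` be entire with `φ` nonconstant.  If `φ` admits an algebraic addition theorem
`G (φ u, φ v, φ (u+v)) = 0` (with `G ≠ 0`) and `ψ` is algebraic over `φ`, i.e.
`H (φ u, ψ u) = 0` for a polynomial `H` of positive degree in the second variable, then
`ψ` also admits an algebraic addition theorem. -/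
theorem AAT_transfers_to_algebraic_function (φ ψ : ℂ → ℂ)
    (hφ : Differentiable ℂ φ) (hψ : Differentiable ℂ ψ)
    (hφnc : ¬ ∃ c : ℂ, ∀ u : ℂ, φ u = c)
    (G : MvPolynomial (Fin 3) ℂ) (hG : G ≠ 0)
    (hAAT : ∀ u v : ℂ, MvPolynomial.eval ![φ u, φ v, φ (u + v)] G = 0)
    (H : MvPolynomial (Fin 2) ℂ) (hHdeg : 0 < H.degreeOf 1)
    (hH : ∀ u : ℂ, MvPolynomial.eval ![φ u, ψ u] H = 0) :
    ∃ g : MvPolynomial (Fin 3) ℂ, g ≠ 0 ∧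
      ∀ u v : ℂ, MvPolynomial.eval ![ψ u, ψ v, ψ (u + v)] g = 0 := by
  let L : Fin 3 → (ℂ × ℂ →L[ℂ] ℂ) := ![.fst ℂ ℂ ℂ, .snd ℂ ℂ ℂ, .fst ℂ ℂ ℂ + .snd ℂ ℂ ℂ]
  have hL (i) : Function.Surjective (L i) := by
    intro u
    fin_cases i
    · exact ⟨(u, 0), rfl⟩
    · exact ⟨(0, u), rfl⟩
    · exact ⟨(u, 0), add_zero u⟩
  have hval (f : ℂ → ℂ) (z : ℂ × ℂ) :
      (fun i ↦ f (L i z)) = ![f z.1, f z.2, f (z.1 + z.2)] := by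
    ext i
    fin_cases i <;> rfl
  have hH0 : H ≠ 0 := by
    rintro rfl
    simp at hHdeg
  have hcl (i) : entireFunctions.comp hψ (L i) ∈
      (AlgebraicIndependent.matroid ℂ (entireFunctions (ℂ × ℂ))).closure
        {entireFunctions.comp hφ (L i)} := by
    refine mem_matroid_closure_singleton_of_aeval_eq_zero
      (entireFunctions.transcendental_comp hφ hφnc (hL i)) hH0 ?_
    rw [entireFunctions.aeval_eq_zero_iff]
    intro z
    refine (congrArg (MvPolynomial.eval · H) (funext fun j ↦ ?_)).trans (hH (L i z))
    fin_cases j <;> rfl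
  have hdep : ¬ AlgebraicIndependent ℂ fun i ↦ entireFunctions.comp hψ (L i) := by
    intro h
    refine hG (algebraicIndependent_iff.1 (h.of_mem_matroid_closure hcl) G ?_)
    rw [entireFunctions.aeval_eq_zero_iff]
    intro z
    exact (congrArg (MvPolynomial.eval · G) (hval φ z)).trans (hAAT z.1 z.2)
  rw [algebraicIndependent_iff] at hdep
  push Not at hdep
  obtain ⟨g, hg, hg0⟩ := hdep
  refine ⟨g, hg0, fun u v ↦ ?_⟩
  rw [← hval ψ (u, v)]
  exact (entireFunctions.aeval_eq_zero_iff _ g).1 hg (u, v)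
end
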